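/- The function E(A) := inf{Per(Ω) + D(Ω) : Ω ⊂ R^3 measurable, |Ω| = A} is subadditive: E(A) ≤ E(A') + E(A − A') for all 0 < A' < A. -/

import Mathlib

open MeasureTheory Filter Metric Set Topology

noncomputable section

/-- De Giorgi perimeter: the set of values `∫_E div F` over admissible vector fields. -/
def perSet (d : ℕ) (E : Set (EuclideanSpace ℝ (Fin d))) : Set ℝ :=
  {p | ∃ F : EuclideanSpace ℝ (Fin d) → EuclideanSpace ℝ (Fin d),
      ContDiff ℝ 1 F ∧ HasCompactSupport F ∧ (∀ x, ‖F x‖ ≤ 1) ∧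
      p = ∫ x in E, ∑ i, fderiv ℝ F x (EuclideanSpace.single i (1:ℝ)) i}

/-- De Giorgi perimeter of a measurable set. -/
def perimeter (d : ℕ) (E : Set (EuclideanSpace ℝ (Fin d))) : ℝ := sSup (perSet d E)

/-- A set has finite perimeter if the defining supremum is finite. -/
def FinitePerimeter (d : ℕ) (E : Set (EuclideanSpace ℝ (Fin d))) : Prop := BddAbove (perSet d E)

/-- Riesz interaction energy. -/
def riesz (d : ℕ) (l : ℝ) (A : Set (EuclideanSpace ℝ (Fin d))) : ℝ :=
  (1/2) * ∫ x in A, ∫ y in A, ‖x - y‖ ^ (-l)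

abbrev E3 := EuclideanSpace ℝ (Fin 3)

/-- Coulomb self-energy in dimension 3. -/
def coulomb (Ω : Set E3) : ℝ := (1/2) * ∫ x in Ω, ∫ y in Ω, ‖x - y‖⁻¹

/-- Liquid drop energy. -/
def ldEnergy (Ω : Set E3) : ℝ := perimeter 3 Ω + coulomb Ω

/-- Minimal liquid drop energy at mass `A`. -/
def ldE (A : ℝ) : ℝ :=
  sInf {e | ∃ Ω : Set E3, MeasurableSet Ω ∧ FinitePerimeter 3 Ω ∧
      volume Ω = ENNReal.ofReal A ∧ e = ldEnergy Ω}

open scoped Convolution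

/-- The divergence of a vector field. -/
def divergence {d : ℕ} (F : EuclideanSpace ℝ (Fin d) → EuclideanSpace ℝ (Fin d))
    (x : EuclideanSpace ℝ (Fin d)) : ℝ :=
  ∑ i, fderiv ℝ F x (EuclideanSpace.single i (1:ℝ)) i

/-- The mollification of `f` by the kernel `ρ`. -/
def mollify {d : ℕ} {V : Type*} [NormedAddCommGroup V] [NormedSpace ℝ V]
    (ρ : EuclideanSpace ℝ (Fin d) → ℝ) (f : EuclideanSpace ℝ (Fin d) → V) :
    EuclideanSpace ℝ (Fin d) → V :=
  f ⋆[(ContinuousLinearMap.lsmul ℝ ℝ : ℝ →L[ℝ] V →L[ℝ] V).flip, volume] ρ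

section Mollify

variable {d : ℕ} {V : Type*} [NormedAddCommGroup V] [NormedSpace ℝ V]
  {ρ : EuclideanSpace ℝ (Fin d) → ℝ} {f : EuclideanSpace ℝ (Fin d) → V}

lemma mollify_apply (ρ : EuclideanSpace ℝ (Fin d) → ℝ) (f : EuclideanSpace ℝ (Fin d) → V)
    (x : EuclideanSpace ℝ (Fin d)) : mollify ρ f x = ∫ t, ρ (x - t) • f t := by
  simp [mollify, convolution_def]

lemma mollify_eq_convolution (ρ : EuclideanSpace ℝ (Fin d) → ℝ)
    (f : EuclideanSpace ℝ (Fin d) → V) :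
    mollify ρ f = ρ ⋆[ContinuousLinearMap.lsmul ℝ ℝ, volume] f := by
  rw [mollify, convolution_flip]

lemma contDiff_mollify (hρ : ContDiff ℝ 1 ρ) (hρc : HasCompactSupport ρ)
    (hf : LocallyIntegrable f volume) : ContDiff ℝ 1 (mollify ρ f) :=
  hρc.contDiff_convolution_right (n := 1) _ hf hρ

lemma fderiv_mollify_apply (hρ : ContDiff ℝ 1 ρ) (hρc : HasCompactSupport ρ)
    (hf : LocallyIntegrable f volume) (x v : EuclideanSpace ℝ (Fin d)) :
    fderiv ℝ (mollify ρ f) x v = mollify (fun y => fderiv ℝ ρ y v) f x := by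
  rw [mollify, (hρc.hasFDerivAt_convolution_right _ hf hρ x).fderiv,
    convolution_precompR_apply _ hf (hρc.fderiv ℝ) (hρ.continuous_fderiv one_ne_zero)]
  rfl

lemma hasCompactSupport_mollify (hρc : HasCompactSupport ρ) (hf : HasCompactSupport f) :
    HasCompactSupport (mollify ρ f) :=
  hf.convolution _ hρc

lemma norm_mollify_le [CompleteSpace V] (hρ0 : ∀ x, 0 ≤ ρ x) (hρ : Integrable ρ)
    (hρ1 : ∫ x, ρ x = 1)
    {C : ℝ} (hf : ∀ x, ‖f x‖ ≤ C) (x : EuclideanSpace ℝ (Fin d)) :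
    ‖mollify ρ f x‖ ≤ C := by
  rw [mollify_apply]
  calc ‖∫ t, ρ (x - t) • f t‖ ≤ ∫ t, ρ (x - t) * C := by
        refine norm_integral_le_of_norm_le ((hρ.comp_sub_left x).mul_const C)
          (.of_forall fun t => ?_)
        rw [norm_smul, Real.norm_of_nonneg (hρ0 _)]
        exact mul_le_mul_of_nonneg_left (hf t) (hρ0 _)
    _ = C := by
        rw [integral_mul_const, integral_sub_left_eq_self ρ, hρ1, one_mul]

end Mollify

section Divergence

variable {d : ℕ} {F : EuclideanSpace ℝ (Fin d) → EuclideanSpace ℝ (Fin d)}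

lemma continuous_divergence (hF : ContDiff ℝ 1 F) : Continuous (divergence F) := by
  have h := hF.continuous_fderiv one_ne_zero
  unfold divergence
  fun_prop

lemma hasCompactSupport_divergence (hF : HasCompactSupport F) :
    HasCompactSupport (divergence F) := by
  refine (hF.fderiv ℝ).mono fun x hx h => hx ?_
  simp [divergence, h]

lemma integrable_divergence (hF : ContDiff ℝ 1 F) (hFc : HasCompactSupport F) :
    Integrable (divergence F) :=
  (continuous_divergence hF).integrable_of_hasCompactSupport (hasCompactSupport_divergence hFc)

lemma integral_divergence_eq_zero (hF : ContDiff ℝ 1 F) (hFc : HasCompactSupport F) :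
    ∫ x, divergence F x = 0 := by
  have hint : ∀ v, Integrable (fun x => fderiv ℝ F x v) := fun v =>
    ((hF.continuous_fderiv one_ne_zero).clm_apply continuous_const).integrable_of_hasCompactSupport
      ((hFc.fderiv ℝ).mono fun x hx h => hx (by simp [h]))
  have h0 : ∀ v, ∫ x, fderiv ℝ F x v = 0 := fun v => by
    have := integral_smul_fderiv_eq_neg_fderiv_smul_of_integrable (𝕜 := ℝ) (μ := volume)
      (f := fun _ : EuclideanSpace ℝ (Fin d) => (1:ℝ)) (g := F) (v := v) (by simp)
      (by simpa using hint v)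
      (by simpa using hF.continuous.integrable_of_hasCompactSupport hFc)
      (by simp) (fun x _ => (hF.differentiable one_ne_zero) x)
    simpa using this
  unfold divergence
  rw [integral_finsetSum _ fun i _ => (hint _).eval_piLp i]
  refine Finset.sum_eq_zero fun i _ => ?_
  have := ContinuousLinearMap.integral_comp_comm (EuclideanSpace.proj (𝕜 := ℝ) i)
    (hint (EuclideanSpace.single i 1))
  simpa [h0] using this

lemma divergence_smul {u : EuclideanSpace ℝ (Fin d) → ℝ} {x : EuclideanSpace ℝ (Fin d)}
    (hu : DifferentiableAt ℝ u x) (hF : DifferentiableAt ℝ F x) :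
    divergence (fun y => u y • F y) x =
      u x * divergence F x + ∑ i, fderiv ℝ u x (EuclideanSpace.single i 1) * F x i := by
  simp [divergence, fderiv_fun_smul hu hF, Finset.sum_add_distrib, Finset.mul_sum]

end Divergence

lemma integral_indicator_mul_mollify {d : ℕ} {A : Set (EuclideanSpace ℝ (Fin d))}
    (hA : MeasurableSet A) {w g : EuclideanSpace ℝ (Fin d) → ℝ}
    (hwi : Integrable w) (hodd : ∀ x, w (-x) = - w x)
    (hg : Integrable g) :
    ∫ x, mollify w (A.indicator 1) x * g x = - ∫ y in A, mollify w g y := by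
  have hI : Integrable (fun p : EuclideanSpace ℝ (Fin d) × EuclideanSpace ℝ (Fin d) =>
      w (p.1 - p.2) * A.indicator 1 p.2 * g p.1) := by
    have h1 := (Integrable.convolution_integrand
      (ContinuousLinearMap.lsmul ℝ ℝ : ℝ →L[ℝ] ℝ →L[ℝ] ℝ) (μ := volume) (ν := volume) hg
      (hwi.comp_neg)).swap
    refine (h1.indicator (s := univ ×ˢ A) (MeasurableSet.univ.prod hA)).congr (.of_forall ?_)
    rintro ⟨x, y⟩
    by_cases hy : y ∈ A <;> simp [hy, mul_comm]
  simp_rw [mollify_apply, ← integral_indicator hA]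
  rw [← integral_neg]
  simp_rw [← integral_mul_const]
  rw [integral_integral_swap hI]
  congr with y
  by_cases hy : y ∈ A
  · simp [hy, ← integral_neg]
    congr with x
    rw [← neg_sub, hodd]
    ring
  · simp [hy]

lemma integrable_fderiv_apply {d : ℕ} {ρ : EuclideanSpace ℝ (Fin d) → ℝ} (hρ : ContDiff ℝ 1 ρ)
    (hρc : HasCompactSupport ρ) (v : EuclideanSpace ℝ (Fin d)) :
    Integrable (fun x => fderiv ℝ ρ x v) :=
  ((hρ.continuous_fderiv one_ne_zero).clm_apply continuous_const).integrable_of_hasCompactSupport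
    (hρc.fderiv_apply ℝ v)

lemma fderiv_neg_apply_of_even {d : ℕ} {ρ : EuclideanSpace ℝ (Fin d) → ℝ}
    (hρ : Differentiable ℝ ρ) (hρe : ∀ x, ρ (-x) = ρ x) (v x : EuclideanSpace ℝ (Fin d)) :
    fderiv ℝ ρ (-x) v = - fderiv ℝ ρ x v := by
  have h := (hρ (-x)).hasFDerivAt.comp x (hasFDerivAt_id x).neg
  have h' : HasFDerivAt ρ _ x := h.congr_of_eventuallyEq (.of_forall fun y => (hρe y).symm)
  simp [h'.fderiv]

lemma fderiv_mollify_coord {d : ℕ} {ρ : EuclideanSpace ℝ (Fin d) → ℝ}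
    (hρ : ContDiff ℝ 1 ρ) (hρc : HasCompactSupport ρ)
    {G : EuclideanSpace ℝ (Fin d) → EuclideanSpace ℝ (Fin d)} (hG : LocallyIntegrable G volume)
    (x v : EuclideanSpace ℝ (Fin d)) (i : Fin d) :
    fderiv ℝ (mollify ρ G) x v i = mollify (fun y => fderiv ℝ ρ y v) (fun y => G y i) x := by
  rw [fderiv_mollify_apply hρ hρc hG, mollify_apply, mollify_apply]
  have hint : Integrable (fun t => fderiv ℝ ρ (x - t) v • G t) :=
    (hρc.fderiv_apply ℝ v).convolutionExists_right (ContinuousLinearMap.lsmul ℝ ℝ).flip hG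
      ((hρ.continuous_fderiv one_ne_zero).clm_apply continuous_const) x
  have := ContinuousLinearMap.integral_comp_comm (EuclideanSpace.proj (𝕜 := ℝ) i) hint
  simpa using this.symm

/-- Pairing the gradient of the mollified indicator of `A` with a vector field restricted to a
measurable set costs at most the perimeter of `A`. -/
lemma neg_integral_gradient_mollify_le {d : ℕ} {A B : Set (EuclideanSpace ℝ (Fin d))}
    (hA : MeasurableSet A) (hB : MeasurableSet B) (hPA : FinitePerimeter d A)
    {ρ : EuclideanSpace ℝ (Fin d) → ℝ} (hρ : ContDiff ℝ 1 ρ) (hρc : HasCompactSupport ρ)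
    (hρ0 : ∀ x, 0 ≤ ρ x) (hρ1 : ∫ x, ρ x = 1) (hρe : ∀ x, ρ (-x) = ρ x)
    {F : EuclideanSpace ℝ (Fin d) → EuclideanSpace ℝ (Fin d)}
    (hF : Continuous F) (hFc : HasCompactSupport F) (hF1 : ∀ x, ‖F x‖ ≤ 1) :
    - ∫ x in B, ∑ i, fderiv ℝ (mollify ρ (A.indicator (1 : EuclideanSpace ℝ (Fin d) → ℝ))) x
      (EuclideanSpace.single i 1) * F x i ≤ perimeter d A := by
  have hρi : Integrable ρ := hρ.continuous.integrable_of_hasCompactSupport hρc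
  have hdρo := fderiv_neg_apply_of_even (hρ.differentiable one_ne_zero) hρe
  have hχ : LocallyIntegrable (A.indicator (1 : EuclideanSpace ℝ (Fin d) → ℝ)) volume :=
    (locallyIntegrable_const (1 : ℝ)).indicator hA
  have hgrad := fderiv_mollify_apply hρ hρc hχ
  have hud := (contDiff_mollify hρ hρc hχ).continuous_fderiv one_ne_zero
  have hGi : Integrable (B.indicator F) := (hF.integrable_of_hasCompactSupport hFc).indicator hB
  have hGc : HasCompactSupport (B.indicator F) := hFc.mono fun x hx h => hx (by
    by_cases hxB : x ∈ B <;> simp [hxB, h])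
  refine le_csSup hPA ⟨mollify ρ (B.indicator F), contDiff_mollify hρ hρc hGi.locallyIntegrable,
    hasCompactSupport_mollify hρc hGc, norm_mollify_le hρ0 hρi hρ1
      fun x => (norm_indicator_le_norm_self F x).trans (hF1 x), ?_⟩
  have hcoord := fderiv_mollify_coord hρ hρc hGi.locallyIntegrable
  have hHc := (hasCompactSupport_mollify hρc hGc).fderiv ℝ
  have hHd := (contDiff_mollify hρ hρc hGi.locallyIntegrable).continuous_fderiv one_ne_zero
  have hHi : ∀ i, Integrable (fun x => mollify (fun y =>
      fderiv ℝ ρ y (EuclideanSpace.single i 1)) (fun y => B.indicator F y i) x) := fun i => by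
    simp_rw [← hcoord]
    exact Continuous.integrable_of_hasCompactSupport (by fun_prop)
      (hHc.mono fun x hx h => hx (by simp [h]))
  have hui : ∀ i, Integrable (fun x => mollify (fun y =>
      fderiv ℝ ρ y (EuclideanSpace.single i 1)) (A.indicator 1) x * B.indicator F x i) :=
    fun i => by
      have h1 : Integrable (fun x => fderiv ℝ (mollify ρ (A.indicator 1)) x
          (EuclideanSpace.single i 1) * F x i) :=
        Continuous.integrable_of_hasCompactSupport (by fun_prop)
          (hFc.mono fun x hx h => hx (by simp [h]))
      refine (h1.indicator hB).congr (.of_forall fun x => ?_)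
      by_cases hx : x ∈ B <;> simp [hx, hgrad]
  have hind : ∀ x, B.indicator
      (fun x => ∑ i, fderiv ℝ (mollify ρ (A.indicator 1)) x (EuclideanSpace.single i 1) * F x i) x =
      ∑ i, mollify (fun y => fderiv ℝ ρ y (EuclideanSpace.single i 1)) (A.indicator 1) x *
        B.indicator F x i := fun x => by
    by_cases hx : x ∈ B <;> simp [hx, hgrad]
  simp_rw [hcoord]
  rw [← integral_indicator hB]
  simp_rw [hind]
  rw [integral_finsetSum _ fun i _ => hui i,
    integral_finsetSum _ fun i _ => (hHi i).integrableOn, ← Finset.sum_neg_distrib]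
  refine Finset.sum_congr rfl fun i _ => ?_
  rw [integral_indicator_mul_mollify hA (integrable_fderiv_apply hρ hρc _) (hdρo _)
    (hGi.eval_piLp i), neg_neg]

lemma integral_cutoff_divergence_le {d : ℕ} {B : Set (EuclideanSpace ℝ (Fin d))}
    (hB : MeasurableSet B) (hPB : FinitePerimeter d B)
    {u : EuclideanSpace ℝ (Fin d) → ℝ} (hud : ContDiff ℝ 1 u) (hu0 : ∀ x, 0 ≤ u x)
    (hu1 : ∀ x, u x ≤ 1) {F : EuclideanSpace ℝ (Fin d) → EuclideanSpace ℝ (Fin d)}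
    (hF : ContDiff ℝ 1 F) (hFc : HasCompactSupport F) (hF1 : ∀ x, ‖F x‖ ≤ 1) :
    (∫ x in B, divergence F x) + ∫ x in Bᶜ, u x * divergence F x ≤
      perimeter d B
        - ∫ x in Bᶜ, ∑ i, fderiv ℝ u x (EuclideanSpace.single i 1) * F x i := by
  have hudiff := hud.differentiable one_ne_zero
  have hFdiff := hF.differentiable one_ne_zero
  have hdiv : ∀ x, divergence F x =
      divergence (fun y => u y • F y) x + divergence (fun y => (1 - u y) • F y) x := fun x => by
    rw [divergence_smul (hudiff x) (hFdiff x),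
      divergence_smul (u := fun y => 1 - u y) ((hudiff x).const_sub 1) (hFdiff x)]
    simp [fderiv_const_sub, Finset.sum_neg_distrib]
    ring
  have hKd : ContDiff ℝ 1 (fun y => u y • F y) := hud.smul hF
  have hKc : HasCompactSupport (fun y => u y • F y) := hFc.mono fun x hx h => hx (by simp [h])
  have hLd : ContDiff ℝ 1 (fun y => (1 - u y) • F y) := (contDiff_const.sub hud).smul hF
  have hLc : HasCompactSupport (fun y => (1 - u y) • F y) := hFc.mono fun x hx h => hx (by simp [h])
  have hL : ∫ x in B, divergence (fun y => (1 - u y) • F y) x ≤ perimeter d B := by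
    refine le_csSup hPB ⟨_, hLd, hLc, fun x => ?_, rfl⟩
    rw [norm_smul, Real.norm_of_nonneg (by linarith [hu1 x])]
    exact mul_le_one₀ (by linarith [hu0 x]) (norm_nonneg _) (hF1 x)
  have hKi := integrable_divergence hKd hKc
  have hLi := integrable_divergence hLd hLc
  have hsplit : ∫ x in B, divergence F x = (∫ x in B, divergence (fun y => u y • F y) x)
      + ∫ x in B, divergence (fun y => (1 - u y) • F y) x := by
    rw [← integral_add hKi.integrableOn hLi.integrableOn]
    exact integral_congr_ae (.of_forall hdiv)
  have hgi : Integrable (fun x => ∑ i, fderiv ℝ u x (EuclideanSpace.single i 1) * F x i) := by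
    refine Continuous.integrable_of_hasCompactSupport ?_ (hFc.mono fun x hx h => hx (by simp [h]))
    have := hud.continuous_fderiv one_ne_zero
    have := hF.continuous
    fun_prop
  have hcompl : ∫ x in Bᶜ, u x * divergence F x = (∫ x in Bᶜ, divergence (fun y => u y • F y) x)
      - ∫ x in Bᶜ, ∑ i, fderiv ℝ u x (EuclideanSpace.single i 1) * F x i := by
    rw [← integral_sub hKi.integrableOn hgi.integrableOn]
    congr with x
    rw [divergence_smul (hudiff x) (hFdiff x)]
    ring
  have hzero := integral_add_compl hB hKi
  rw [integral_divergence_eq_zero hKd hKc] at hzero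
  linarith

lemma mollify_union_estimate {d : ℕ} {A B : Set (EuclideanSpace ℝ (Fin d))}
    (hA : MeasurableSet A) (hB : MeasurableSet B)
    (hPA : FinitePerimeter d A) (hPB : FinitePerimeter d B)
    {ρ : EuclideanSpace ℝ (Fin d) → ℝ} (hρ : ContDiff ℝ 1 ρ) (hρc : HasCompactSupport ρ)
    (hρ0 : ∀ x, 0 ≤ ρ x) (hρ1 : ∫ x, ρ x = 1) (hρe : ∀ x, ρ (-x) = ρ x)
    {F : EuclideanSpace ℝ (Fin d) → EuclideanSpace ℝ (Fin d)}
    (hF : ContDiff ℝ 1 F) (hFc : HasCompactSupport F) (hF1 : ∀ x, ‖F x‖ ≤ 1) :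
    (∫ x in B, divergence F x)
      + ∫ x in Bᶜ, mollify ρ (A.indicator (1 : EuclideanSpace ℝ (Fin d) → ℝ)) x * divergence F x
      ≤ perimeter d A + perimeter d B := by
  have hρi : Integrable ρ := hρ.continuous.integrable_of_hasCompactSupport hρc
  set χ : EuclideanSpace ℝ (Fin d) → ℝ := A.indicator 1
  have hχ : LocallyIntegrable χ volume :=
    (locallyIntegrable_const (1 : ℝ)).indicator hA
  have hχ01 : ∀ x, 0 ≤ χ x ∧ χ x ≤ 1 := fun x => by
    by_cases hx : x ∈ A <;> simp [χ, hx]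
  set u := mollify ρ χ with hu
  have hud : ContDiff ℝ 1 u := contDiff_mollify hρ hρc hχ
  have hu0 : ∀ x, 0 ≤ u x := fun x => by
    rw [hu, mollify_apply]
    exact integral_nonneg fun t => mul_nonneg (hρ0 _) (hχ01 t).1
  have hu1 : ∀ x, u x ≤ 1 := fun x =>
    (Real.le_norm_self _).trans (norm_mollify_le hρ0 hρi hρ1
      (fun t => (Real.norm_of_nonneg (hχ01 t).1).trans_le (hχ01 t).2) x)
  have key : - ∫ x in Bᶜ, ∑ i, fderiv ℝ u x (EuclideanSpace.single i 1) * F x i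
      ≤ perimeter d A :=
    neg_integral_gradient_mollify_le hA hB.compl hPA hρ hρc hρ0 hρ1 hρe hF.continuous hFc hF1
  have := integral_cutoff_divergence_le hB hPB hud hu0 hu1 hF hFc hF1
  linarith

lemma integral_union_divergence_le {d : ℕ} {A B : Set (EuclideanSpace ℝ (Fin d))}
    (hA : MeasurableSet A) (hB : MeasurableSet B)
    (hPA : FinitePerimeter d A) (hPB : FinitePerimeter d B)
    {F : EuclideanSpace ℝ (Fin d) → EuclideanSpace ℝ (Fin d)}
    (hF : ContDiff ℝ 1 F) (hFc : HasCompactSupport F) (hF1 : ∀ x, ‖F x‖ ≤ 1) :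
    ∫ x in A ∪ B, divergence F x ≤ perimeter d A + perimeter d B := by
  let φ : ℕ → ContDiffBump (0 : EuclideanSpace ℝ (Fin d)) := fun n =>
    ⟨1 / ((n : ℝ) + 1), 2 * (1 / ((n : ℝ) + 1)), by positivity, by
      have : 0 < 1 / ((n : ℝ) + 1) := by positivity
      linarith⟩
  set χ : EuclideanSpace ℝ (Fin d) → ℝ := A.indicator 1
  have hχ : LocallyIntegrable χ volume :=
    (locallyIntegrable_const (1 : ℝ)).indicator hA
  have hχ1 : ∀ x, ‖χ x‖ ≤ 1 := fun x => by
    by_cases hx : x ∈ A <;> simp [χ, hx]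
  have hφ : Tendsto (fun n => (φ n).rOut) atTop (𝓝 0) := by
    have := (tendsto_one_div_add_atTop_nhds_zero_nat (𝕜 := ℝ)).const_mul 2
    rwa [mul_zero] at this
  have hae := ContDiffBump.ae_convolution_tendsto_right_of_locallyIntegrable (μ := volume)
    (K := 2) hφ (.of_forall fun n => le_rfl) hχ
  have hdi := integrable_divergence hF hFc
  have hlim : Tendsto (fun n => ∫ x in Bᶜ, mollify ((φ n).normed volume) χ x * divergence F x)
      atTop (𝓝 (∫ x in Bᶜ, χ x * divergence F x)) := by
    refine tendsto_integral_of_dominated_convergence (fun x => ‖divergence F x‖) (fun n => ?_)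
      hdi.norm.integrableOn (fun n => .of_forall fun x => ?_) (ae_restrict_of_ae ?_)
    · exact ((contDiff_mollify (φ n).contDiff_normed (φ n).hasCompactSupport_normed
        hχ).continuous.mul (continuous_divergence hF)).aestronglyMeasurable
    · rw [norm_mul]
      exact mul_le_of_le_one_left (norm_nonneg _) (norm_mollify_le (φ n).nonneg_normed
        (φ n).integrable_normed (φ n).integral_normed hχ1 x)
    · filter_upwards [hae] with x hx
      simp_rw [mollify_eq_convolution]
      exact hx.mul_const _
  have hunion : ∫ x in A ∪ B, divergence F x
      = (∫ x in B, divergence F x) + ∫ x in Bᶜ, χ x * divergence F x := by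
    have hχmul : ∀ x, χ x * divergence F x = A.indicator (divergence F) x := fun x => by
      by_cases hx : x ∈ A <;> simp [χ, hx]
    simp_rw [hχmul]
    rw [setIntegral_indicator hA,
      ← integral_inter_add_sdiff hB (hdi.integrableOn (s := A ∪ B)),
      union_inter_cancel_right, union_sdiff_right, sdiff_eq, inter_comm A]
  rw [hunion]
  exact le_of_tendsto (hlim.const_add _) (.of_forall fun n =>
    mollify_union_estimate hA hB hPA hPB (φ n).contDiff_normed (φ n).hasCompactSupport_normed
      (φ n).nonneg_normed (φ n).integral_normed (φ n).normed_neg hF hFc hF1)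

lemma finitePerimeter_union {d : ℕ} {A B : Set (EuclideanSpace ℝ (Fin d))}
    (hA : MeasurableSet A) (hB : MeasurableSet B)
    (hPA : FinitePerimeter d A) (hPB : FinitePerimeter d B) : FinitePerimeter d (A ∪ B) := by
  refine ⟨perimeter d A + perimeter d B, ?_⟩
  rintro p ⟨F, hF, hFc, hF1, rfl⟩
  exact integral_union_divergence_le hA hB hPA hPB hF hFc hF1

lemma zero_mem_perSet (d : ℕ) (E : Set (EuclideanSpace ℝ (Fin d))) : 0 ∈ perSet d E :=
  ⟨0, contDiff_const, HasCompactSupport.zero, by simp, by simp⟩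

lemma perimeter_nonneg {d : ℕ} {E : Set (EuclideanSpace ℝ (Fin d))} (hE : FinitePerimeter d E) :
    0 ≤ perimeter d E :=
  le_csSup hE (zero_mem_perSet d E)

lemma perimeter_union_le {d : ℕ} {A B : Set (EuclideanSpace ℝ (Fin d))}
    (hA : MeasurableSet A) (hB : MeasurableSet B)
    (hPA : FinitePerimeter d A) (hPB : FinitePerimeter d B) :
    perimeter d (A ∪ B) ≤ perimeter d A + perimeter d B := by
  refine csSup_le ⟨0, zero_mem_perSet d _⟩ ?_
  rintro p ⟨F, hF, hFc, hF1, rfl⟩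
  exact integral_union_divergence_le hA hB hPA hPB hF hFc hF1

section Affine

variable {d : ℕ} {V : Type*} [NormedAddCommGroup V] [NormedSpace ℝ V]

lemma setIntegral_preimage_affine {T : Set (EuclideanSpace ℝ (Fin d))} (hT : MeasurableSet T)
    {s : ℝ} (hs : 0 < s) (w : EuclideanSpace ℝ (Fin d)) (g : EuclideanSpace ℝ (Fin d) → V) :
    ∫ y in (fun y => s • y + w) ⁻¹' T, g (s • y + w) = (s ^ d)⁻¹ • ∫ x in T, g x := by
  have hm : Measurable fun y : EuclideanSpace ℝ (Fin d) => s • y + w := by fun_prop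
  rw [← integral_indicator hT, ← integral_indicator (hm hT),
    ← integral_add_right_eq_self (T.indicator g) w]
  have h := Measure.integral_comp_smul volume (fun y => T.indicator g (y + w)) s
  rw [finrank_euclideanSpace_fin, abs_of_pos (by positivity)] at h
  rw [← h]
  rfl

lemma volume_preimage_affine (T : Set (EuclideanSpace ℝ (Fin d)))
    {s : ℝ} (hs : 0 < s) (w : EuclideanSpace ℝ (Fin d)) :
    volume ((fun y => s • y + w) ⁻¹' T) = ENNReal.ofReal (s ^ d)⁻¹ * volume T := by
  have h := Measure.addHaar_preimage_smul volume hs.ne' ((fun y => y + w) ⁻¹' T)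
  rw [finrank_euclideanSpace_fin, abs_of_pos (by positivity), measure_preimage_add_right] at h
  exact h

lemma perSet_preimage_affine {T : Set (EuclideanSpace ℝ (Fin d))} (hT : MeasurableSet T)
    {s : ℝ} (hs : 0 < s) (w : EuclideanSpace ℝ (Fin d)) {p : ℝ}
    (hp : p ∈ perSet d ((fun y => s • y + w) ⁻¹' T)) :
    ∃ q ∈ perSet d T, p = s * (s ^ d)⁻¹ * q := by
  obtain ⟨F, hF, hFc, hF1, rfl⟩ := hp
  have hG : ContDiff ℝ 1 fun x => F (s⁻¹ • (x - w)) := hF.comp (by fun_prop)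
  refine ⟨_, ⟨fun x => F (s⁻¹ • (x - w)), hG, ?_, fun x => hF1 _, rfl⟩, ?_⟩
  · exact hFc.comp_homeomorph
      ((Homeomorph.subRight w).trans (Homeomorph.smulOfNeZero s⁻¹ (inv_ne_zero hs.ne')))
  · have h := setIntegral_preimage_affine hT hs w (divergence fun x => F (s⁻¹ • (x - w)))
    change _ = s * (s ^ d)⁻¹ * ∫ x in T, divergence (fun x => F (s⁻¹ • (x - w))) x
    rw [mul_assoc, ← smul_eq_mul (a := (s ^ d)⁻¹), ← h, ← integral_const_mul]
    congr with y
    have hinv : ∀ x, F (s⁻¹ • (s • x + w - w)) = F x := fun x => by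
      rw [add_sub_cancel_right, inv_smul_smul₀ hs.ne']
    have h1 : HasFDerivAt (fun y : EuclideanSpace ℝ (Fin d) => s • y + w)
        (s • ContinuousLinearMap.id ℝ _) y := ((hasFDerivAt_id y).const_smul s).add_const w
    have h2 := ((hG.differentiable one_ne_zero) (s • y + w)).hasFDerivAt.comp y h1
    have h3 : HasFDerivAt F _ y := h2.congr_of_eventuallyEq (.of_forall fun y => (hinv y).symm)
    simp [divergence, h3.fderiv, Finset.mul_sum]

lemma finitePerimeter_preimage_affine {T : Set (EuclideanSpace ℝ (Fin d))} (hT : MeasurableSet T)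
    (hPT : FinitePerimeter d T) {s : ℝ} (hs : 0 < s) (w : EuclideanSpace ℝ (Fin d)) :
    FinitePerimeter d ((fun y => s • y + w) ⁻¹' T) := by
  refine ⟨s * (s ^ d)⁻¹ * perimeter d T, fun p hp => ?_⟩
  obtain ⟨q, hq, rfl⟩ := perSet_preimage_affine hT hs w hp
  exact mul_le_mul_of_nonneg_left (le_csSup hPT hq) (by positivity)

lemma perimeter_preimage_affine_le {T : Set (EuclideanSpace ℝ (Fin d))} (hT : MeasurableSet T)
    (hPT : FinitePerimeter d T) {s : ℝ} (hs : 0 < s) (w : EuclideanSpace ℝ (Fin d)) :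
    perimeter d ((fun y => s • y + w) ⁻¹' T) ≤ s * (s ^ d)⁻¹ * perimeter d T := by
  refine csSup_le ⟨0, zero_mem_perSet d _⟩ fun p hp => ?_
  obtain ⟨q, hq, rfl⟩ := perSet_preimage_affine hT hs w hp
  exact mul_le_mul_of_nonneg_left (le_csSup hPT hq) (by positivity)

lemma coulomb_preimage_affine {T : Set E3} (hT : MeasurableSet T) {s : ℝ} (hs : 0 < s) (w : E3) :
    coulomb ((fun y => s • y + w) ⁻¹' T) = s * (s ^ 3)⁻¹ * (s ^ 3)⁻¹ * coulomb T := by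
  have hk : ∀ x y : E3, ‖x - y‖⁻¹ = s * ‖(s • x + w) - (s • y + w)‖⁻¹ := fun x y => by
    rw [add_sub_add_right_eq_sub, ← smul_sub, norm_smul, Real.norm_of_nonneg hs.le, mul_inv,
      mul_inv_cancel_left₀ hs.ne']
  have hin : ∀ x : E3, ∫ y in (fun y => s • y + w) ⁻¹' T, ‖x - y‖⁻¹
      = s * ((s ^ 3)⁻¹ * ∫ y in T, ‖(s • x + w) - y‖⁻¹) := fun x => by
    rw [← smul_eq_mul (a := (s ^ 3)⁻¹),
      ← setIntegral_preimage_affine hT hs w fun y => ‖(s • x + w) - y‖⁻¹, ← integral_const_mul]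
    exact integral_congr_ae (.of_forall (hk x))
  unfold coulomb
  simp_rw [hin, integral_const_mul]
  rw [setIntegral_preimage_affine hT hs w fun x => ∫ y in T, ‖x - y‖⁻¹, smul_eq_mul]
  ring

end Affine

/-- The mutual Coulomb energy of two sets, as an extended nonnegative real. -/
def mutualCoulomb (S T : Set E3) : ENNReal :=
  ∫⁻ x in S, ∫⁻ y in T, ENNReal.ofReal ‖x - y‖⁻¹

lemma mutualCoulomb_comm (S T : Set E3) : mutualCoulomb S T = mutualCoulomb T S := by
  unfold mutualCoulomb
  rw [lintegral_lintegral_swap (by fun_prop)]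
  simp_rw [norm_sub_rev]

lemma mutualCoulomb_union_le (S T : Set E3) :
    mutualCoulomb (S ∪ T) (S ∪ T) ≤
      mutualCoulomb S S + mutualCoulomb T T + 2 * mutualCoulomb S T := by
  have hr : ∀ R, mutualCoulomb R (S ∪ T) ≤ mutualCoulomb R S + mutualCoulomb R T := fun R => by
    rw [mutualCoulomb_comm, mutualCoulomb_comm R S, mutualCoulomb_comm R T]
    exact lintegral_union_le _ _ _
  calc mutualCoulomb (S ∪ T) (S ∪ T) ≤ mutualCoulomb S (S ∪ T) + mutualCoulomb T (S ∪ T) :=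
        lintegral_union_le _ _ _
    _ ≤ (mutualCoulomb S S + mutualCoulomb S T) + (mutualCoulomb T S + mutualCoulomb T T) :=
        add_le_add (hr S) (hr T)
    _ = _ := by rw [mutualCoulomb_comm T S]; ring

/-- The Coulomb kernel truncated to the ball of radius `s`. -/
def nearKernel (s : ℝ) : E3 → ENNReal :=
  (ball 0 s).indicator fun z => ENNReal.ofReal ‖z‖⁻¹

@[fun_prop]
lemma measurable_nearKernel (s : ℝ) : Measurable (nearKernel s) :=
  Measurable.indicator (by fun_prop) measurableSet_ball

lemma lintegral_nearKernel_lt_top (s : ℝ) : ∫⁻ z, nearKernel s z < ⊤ := by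
  have h : IntegrableOn (fun z : E3 => ‖z‖⁻¹) (ball 0 s) := by
    rw [integrableOn_fun_norm_addHaar volume (f := fun r => r⁻¹), finrank_euclideanSpace_fin]
    refine IntegrableOn.congr_fun (f := fun r : ℝ => r) ?_ (fun r hr => ?_) measurableSet_Ioo
    · exact (continuous_id.integrableOn_Icc (a := 0) (b := s)).mono_set Ioo_subset_Icc_self
    · have := hr.1.ne'
      simp only [smul_eq_mul]
      field_simp
  unfold nearKernel
  rw [lintegral_indicator measurableSet_ball]
  exact h.lintegral_lt_top

lemma ofReal_inv_norm_le {s : ℝ} (hs : 0 < s) (z : E3) :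
    ENNReal.ofReal ‖z‖⁻¹ ≤ nearKernel s z + ENNReal.ofReal s⁻¹ := by
  by_cases hz : z ∈ ball 0 s
  · simp [nearKernel, hz]
  · refine le_add_left (ENNReal.ofReal_le_ofReal ?_)
    rw [mem_ball_zero_iff, not_lt] at hz
    exact inv_anti₀ hs hz

lemma mutualCoulomb_le {s : ℝ} (hs : 0 < s) (S T : Set E3) :
    mutualCoulomb S T ≤ (∫⁻ x in S, ∫⁻ y in T, nearKernel s (x - y)) +
      volume S * volume T * ENNReal.ofReal s⁻¹ := by
  calc mutualCoulomb S T
      ≤ ∫⁻ x in S, ∫⁻ y in T, (nearKernel s (x - y) + ENNReal.ofReal s⁻¹) :=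
        lintegral_mono fun x => lintegral_mono fun y => ofReal_inv_norm_le hs _
    _ = _ := by
        simp_rw [lintegral_add_right _ measurable_const, setLIntegral_const]
        ring

lemma potential_lt_top {T : Set E3} (hT : volume T ≠ ⊤) (x : E3) :
    ∫⁻ y in T, ENNReal.ofReal ‖x - y‖⁻¹ < ⊤ := by
  calc ∫⁻ y in T, ENNReal.ofReal ‖x - y‖⁻¹
      ≤ ∫⁻ y in T, (nearKernel 1 (x - y) + ENNReal.ofReal 1⁻¹) :=
        lintegral_mono fun y => ofReal_inv_norm_le one_pos _
    _ ≤ (∫⁻ y, nearKernel 1 (x - y)) + ENNReal.ofReal 1⁻¹ * volume T := by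
        rw [lintegral_add_right _ measurable_const, setLIntegral_const]
        gcongr
        exact Measure.restrict_le_self
    _ < ⊤ := by
        rw [lintegral_sub_left_eq_self]
        exact ENNReal.add_lt_top.2 ⟨lintegral_nearKernel_lt_top 1,
          ENNReal.mul_lt_top ENNReal.ofReal_lt_top hT.lt_top⟩

lemma mutualCoulomb_lt_top {S T : Set E3} (hS : volume S ≠ ⊤) (hT : volume T ≠ ⊤) :
    mutualCoulomb S T < ⊤ := by
  refine (mutualCoulomb_le one_pos S T).trans_lt (ENNReal.add_lt_top.2 ⟨?_, ?_⟩)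
  · calc ∫⁻ x in S, ∫⁻ y in T, nearKernel 1 (x - y)
        ≤ ∫⁻ _ in S, ∫⁻ y, nearKernel 1 y := lintegral_mono fun x => by
          rw [← lintegral_sub_left_eq_self (nearKernel 1) x]
          exact setLIntegral_le_lintegral _ _
      _ < ⊤ := by
          rw [setLIntegral_const]
          exact ENNReal.mul_lt_top (lintegral_nearKernel_lt_top 1) hS.lt_top
  · exact ENNReal.mul_lt_top (ENNReal.mul_lt_top hS.lt_top hT.lt_top) ENNReal.ofReal_lt_top

lemma coulomb_eq_mutualCoulomb {Ω : Set E3} (hΩ : volume Ω ≠ ⊤) :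
    coulomb Ω = 1 / 2 * (mutualCoulomb Ω Ω).toReal := by
  have hin : ∀ x : E3, ∫ y in Ω, ‖x - y‖⁻¹ = (∫⁻ y in Ω, ENNReal.ofReal ‖x - y‖⁻¹).toReal :=
    fun x => integral_eq_lintegral_of_nonneg_ae (.of_forall fun y => by positivity)
      (by fun_prop)
  unfold coulomb mutualCoulomb
  simp_rw [hin]
  rw [integral_toReal _ (.of_forall fun x => potential_lt_top hΩ x)]
  exact (Measurable.lintegral_prod_right' (f := fun p : E3 × E3 => ENNReal.ofReal ‖p.1 - p.2‖⁻¹)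
    (by fun_prop)).aemeasurable

lemma coulomb_nonneg (Ω : Set E3) : 0 ≤ coulomb Ω := by
  unfold coulomb
  positivity

lemma exists_le_of_lintegral_lt_top {α : Type*} [MeasurableSpace α] {μ : Measure α}
    (hμ : μ univ = ⊤) {h : α → ENNReal} (hh : ∫⁻ a, h a ∂μ < ⊤) {δ : ENNReal} (hδ : δ ≠ 0) :
    ∃ a, h a ≤ δ := by
  by_contra! hcon
  have : ∫⁻ _, δ ∂μ ≤ ∫⁻ a, h a ∂μ := lintegral_mono fun a => (hcon a).le
  rw [lintegral_const, hμ, ENNReal.mul_top hδ] at this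
  exact (this.trans_lt hh).false

lemma volume_inter_translate (S : Set E3) {T : Set E3} (hT : MeasurableSet T) (v : E3) :
    volume (S ∩ (fun y => y + v) ⁻¹' T) = ∫⁻ x in S, T.indicator 1 (x + v) := by
  have hm : MeasurableSet ((fun y => y + v) ⁻¹' T) := (by fun_prop : Measurable _) hT
  rw [inter_comm, ← Measure.restrict_apply hm, ← lintegral_indicator_one hm]
  rfl

lemma lintegral_translate_eq {S T : Set E3} {κ : E3 → ENNReal} (hκ : Measurable κ) :
    ∫⁻ v : E3, ∫⁻ x in S, ∫⁻ y in T, κ (x + v - y) = volume S * volume T * ∫⁻ z, κ z := by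
  rw [lintegral_lintegral_swap (Measurable.aemeasurable <|
    Measurable.lintegral_prod_right' (f := fun p : (E3 × E3) × E3 => κ (p.1.2 + p.1.1 - p.2))
    (by fun_prop))]
  have : ∀ x : E3, ∫⁻ v : E3, ∫⁻ y in T, κ (x + v - y) = volume T * ∫⁻ z, κ z := fun x => by
    rw [lintegral_lintegral_swap (by fun_prop)]
    have : ∀ y : E3, ∫⁻ v, κ (x + v - y) = ∫⁻ z, κ z := fun y => by
      rw [← lintegral_add_left_eq_self κ (x - y)]
      congr with v
      congr 1
      abel
    simp_rw [this, setLIntegral_const]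
    ring
  simp_rw [this, setLIntegral_const]
  ring

lemma setLIntegral_preimage_translate {T : Set E3} (hT : MeasurableSet T) (v : E3)
    (f : E3 → ENNReal) :
    ∫⁻ y in (fun y => y + v) ⁻¹' T, f y = ∫⁻ y in T, f (y - v) := by
  have hm : MeasurableSet ((fun y => y + v) ⁻¹' T) := (by fun_prop : Measurable _) hT
  rw [← lintegral_indicator hT, ← lintegral_indicator hm,
    ← lintegral_add_right_eq_self (T.indicator fun y => f (y - v)) v]
  congr with y
  by_cases hy : y + v ∈ T <;> simp [hy]

/-- Two sets of finite volume can be translated so as to have small overlap and small mutual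
Coulomb energy. -/
lemma exists_translate_small {S T : Set E3} (hT : MeasurableSet T)
    (hSv : volume S ≠ ⊤) (hTv : volume T ≠ ⊤) {ε : ℝ} (hε : 0 < ε) :
    ∃ v : E3, mutualCoulomb S ((fun y => y + v) ⁻¹' T) ≤ ENNReal.ofReal ε ∧
      volume (S ∩ (fun y => y + v) ⁻¹' T) ≤ ENNReal.ofReal ε := by
  set M := (volume S * volume T).toReal with hM
  have hM0 : 0 ≤ M := ENNReal.toReal_nonneg
  have hMv : volume S * volume T = ENNReal.ofReal M :=
    (ENNReal.ofReal_toReal (ENNReal.mul_ne_top hSv hTv)).symm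
  set s := (2 * M + 1) / ε with hs
  have hs0 : 0 < s := by positivity
  have hfar : volume S * volume T * ENNReal.ofReal s⁻¹ ≤ ENNReal.ofReal (ε / 2) := by
    rw [hMv, ← ENNReal.ofReal_mul hM0]
    refine ENNReal.ofReal_le_ofReal ?_
    rw [hs, inv_div, mul_div_assoc', div_le_div_iff₀ (by positivity) two_pos]
    nlinarith
  have hmeas : Measurable fun v : E3 => ∫⁻ x in S, T.indicator (1 : E3 → ENNReal) (x + v) :=
    Measurable.lintegral_prod_right'
      (f := fun p : E3 × E3 => T.indicator (1 : E3 → ENNReal) (p.2 + p.1))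
      ((measurable_one.indicator hT).comp (by fun_prop))
  have hoverlap : ∫⁻ v : E3, ∫⁻ x in S, T.indicator (1 : E3 → ENNReal) (x + v)
      = volume S * volume T := by
    rw [lintegral_lintegral_swap (f := fun v x : E3 => T.indicator (1 : E3 → ENNReal) (x + v))
      ((measurable_one.indicator hT).comp
        (by fun_prop : Measurable fun p : E3 × E3 => p.2 + p.1)).aemeasurable]
    simp_rw [lintegral_add_left_eq_self, lintegral_indicator_one hT, setLIntegral_const]
    ring
  have hint : ∫⁻ v : E3, ((∫⁻ x in S, ∫⁻ y in T, nearKernel s (x + v - y)) +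
      ∫⁻ x in S, T.indicator 1 (x + v)) < ⊤ := by
    rw [lintegral_add_right _ hmeas, hoverlap, lintegral_translate_eq (measurable_nearKernel s)]
    have := ENNReal.mul_lt_top hSv.lt_top hTv.lt_top
    exact ENNReal.add_lt_top.2 ⟨ENNReal.mul_lt_top this (lintegral_nearKernel_lt_top s), this⟩
  obtain ⟨v, hv⟩ := exists_le_of_lintegral_lt_top (measure_univ_of_isAddLeftInvariant _) hint
    (δ := ENNReal.ofReal (ε / 2)) (by simpa using hε)
  refine ⟨v, ?_, ?_⟩
  · have hnear : ∫⁻ x in S, ∫⁻ y in (fun y => y + v) ⁻¹' T, nearKernel s (x - y)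
        = ∫⁻ x in S, ∫⁻ y in T, nearKernel s (x + v - y) := by
      congr with x
      rw [setLIntegral_preimage_translate hT]
      congr with y
      congr 1
      abel
    have h := mutualCoulomb_le hs0 S ((fun y => y + v) ⁻¹' T)
    rw [hnear, measure_preimage_add_right] at h
    calc _ ≤ _ := h
      _ ≤ ENNReal.ofReal (ε / 2) + ENNReal.ofReal (ε / 2) :=
        add_le_add (le_self_add.trans hv) hfar
      _ = ENNReal.ofReal ε := by
        rw [← ENNReal.ofReal_add (by positivity) (by positivity), add_halves]
  · rw [volume_inter_translate S hT]
    exact (le_add_self.trans hv).trans (ENNReal.ofReal_le_ofReal (by linarith))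

/-- The energies of competitors of volume `A`. -/
def ldValues (A : ℝ) : Set ℝ :=
  {e | ∃ Ω : Set E3, MeasurableSet Ω ∧ FinitePerimeter 3 Ω ∧
      volume Ω = ENNReal.ofReal A ∧ e = ldEnergy Ω}

lemma nonneg_of_mem_ldValues {A e : ℝ} (he : e ∈ ldValues A) : 0 ≤ e := by
  obtain ⟨Ω, -, hP, -, rfl⟩ := he
  exact add_nonneg (perimeter_nonneg hP) (coulomb_nonneg Ω)

lemma ldE_le {A e : ℝ} (he : e ∈ ldValues A) : ldE A ≤ e :=
  csInf_le ⟨0, fun _ => nonneg_of_mem_ldValues⟩ he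

/-- Rescaling a competitor of volume `a` to volume `A`. -/
lemma exists_mem_ldValues_of_volume {a A : ℝ} (ha : 0 < a) (hA : 0 < A) {Ω : Set E3}
    (hΩ : MeasurableSet Ω) (hP : FinitePerimeter 3 Ω) (hv : volume Ω = ENNReal.ofReal a) :
    ∃ s : ℝ, 0 < s ∧ s ^ 3 = a / A ∧ ∃ e ∈ ldValues A,
      e ≤ s * (s ^ 3)⁻¹ * perimeter 3 Ω + s * (s ^ 3)⁻¹ * (s ^ 3)⁻¹ * coulomb Ω := by
  set s : ℝ := (a / A) ^ (1 / 3 : ℝ)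
  have hs : 0 < s := by positivity
  have hs3 : s ^ 3 = a / A := by
    rw [← Real.rpow_natCast, ← Real.rpow_mul (by positivity)]
    norm_num
  refine ⟨s, hs, hs3, _, ⟨(fun y => s • y + 0) ⁻¹' Ω, (by fun_prop : Measurable _) hΩ,
    finitePerimeter_preimage_affine hΩ hP hs 0, ?_, rfl⟩, ?_⟩
  · rw [volume_preimage_affine _ hs, hv, hs3, ← ENNReal.ofReal_mul (by positivity), inv_div,
      div_mul_cancel₀ _ ha.ne']
  · rw [ldEnergy, coulomb_preimage_affine hΩ hs]
    exact add_le_add_left (perimeter_preimage_affine_le hΩ hP hs 0) _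

lemma ldValues_nonempty {a A : ℝ} (ha : 0 < a) (hA : 0 < A) (h : (ldValues a).Nonempty) :
    (ldValues A).Nonempty := by
  obtain ⟨_, Ω, hΩ, hP, hv, rfl⟩ := h
  obtain ⟨_, _, _, e, he, _⟩ := exists_mem_ldValues_of_volume ha hA hΩ hP hv
  exact ⟨e, he⟩

lemma ldE_le_of_volume {a A : ℝ} (ha : 0 < a) (haA : a ≤ A) {Ω : Set E3}
    (hΩ : MeasurableSet Ω) (hP : FinitePerimeter 3 Ω) (hv : volume Ω = ENNReal.ofReal a) :
    ldE A ≤ (A / a) ^ 2 * ldEnergy Ω := by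
  have hA := ha.trans_le haA
  obtain ⟨s, hs, hs3, e, he, hle⟩ := exists_mem_ldValues_of_volume ha hA hΩ hP hv
  have hr : (s ^ 3)⁻¹ = A / a := by rw [hs3, inv_div]
  have hr1 : 1 ≤ A / a := (one_le_div ha).2 haA
  have hs1 : s ≤ 1 := by
    by_contra! h
    have : 1 < s ^ 3 := one_lt_pow₀ h (by norm_num)
    rw [hs3, lt_div_iff₀ hA] at this
    linarith
  rw [hr] at hle
  have hp := perimeter_nonneg hP
  have hc := coulomb_nonneg Ω
  have h1 : s * (A / a) ≤ (A / a) ^ 2 := by nlinarith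
  have h2 : s * (A / a) * (A / a) ≤ (A / a) ^ 2 := by nlinarith
  calc ldE A ≤ e := ldE_le he
    _ ≤ _ := hle
    _ ≤ (A / a) ^ 2 * perimeter 3 Ω + (A / a) ^ 2 * coulomb Ω :=
      add_le_add (mul_le_mul_of_nonneg_right h1 hp) (mul_le_mul_of_nonneg_right h2 hc)
    _ = _ := by rw [ldEnergy]; ring

lemma ldE_add_le_of_pos {a b ε : ℝ} (ha : 0 < a) (hb : 0 < b) (hε : 0 < ε) (hεab : ε < a + b)
    {S T : Set E3} (hS : MeasurableSet S) (hT : MeasurableSet T) (hPS : FinitePerimeter 3 S)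
    (hPT : FinitePerimeter 3 T) (hSv : volume S = ENNReal.ofReal a)
    (hTv : volume T = ENNReal.ofReal b) :
    ldE (a + b) ≤ ((a + b) / (a + b - ε)) ^ 2 * (ldEnergy S + ldEnergy T + ε) := by
  have hSv' : volume S ≠ ⊤ := by simp [hSv]
  have hTv' : volume T ≠ ⊤ := by simp [hTv]
  obtain ⟨v, hmut, hint⟩ := exists_translate_small hT hSv' hTv' hε
  have hform : (fun y : E3 => (1 : ℝ) • y + v) = fun y => y + v := by simp
  set R := (fun y => y + v) ⁻¹' T with hR
  have hRm : MeasurableSet R := (by fun_prop : Measurable _) hT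
  have hRv : volume R = volume T := measure_preimage_add_right _ _ _
  have hRv' : volume R ≠ ⊤ := hRv ▸ hTv'
  have hPR : FinitePerimeter 3 R := by
    simpa [hform] using finitePerimeter_preimage_affine hT hPT one_pos v
  have hRper : perimeter 3 R ≤ perimeter 3 T := by
    simpa [hform] using perimeter_preimage_affine_le hT hPT one_pos v
  have hRcou : coulomb R = coulomb T := by
    simpa [hform] using coulomb_preimage_affine hT one_pos v
  have hUv' : volume (S ∪ R) ≠ ⊤ := measure_union_ne_top hSv' hRv'
  have hvol : volume.real (S ∪ R) + volume.real (S ∩ R) = a + b := by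
    rw [measureReal_union_add_inter hRm hSv' hRv', measureReal_def, measureReal_def, hRv, hSv, hTv,
      ENNReal.toReal_ofReal ha.le, ENNReal.toReal_ofReal hb.le]
  have hm0 : 0 ≤ volume.real (S ∩ R) := measureReal_nonneg
  have hm : volume.real (S ∩ R) ≤ ε := ENNReal.toReal_le_of_le_ofReal hε.le hint
  have hcou : coulomb (S ∪ R) ≤ coulomb S + coulomb T + ε := by
    rw [← hRcou, coulomb_eq_mutualCoulomb hUv', coulomb_eq_mutualCoulomb hSv',
      coulomb_eq_mutualCoulomb hRv']
    have hSS := (mutualCoulomb_lt_top hSv' hSv').ne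
    have hRR := (mutualCoulomb_lt_top hRv' hRv').ne
    have hSR := (mutualCoulomb_lt_top hSv' hRv').ne
    have h := ENNReal.toReal_mono (by finiteness) (mutualCoulomb_union_le S R)
    rw [ENNReal.toReal_add (by finiteness) (by finiteness), ENNReal.toReal_add hSS hRR,
      ENNReal.toReal_mul, ENNReal.toReal_ofNat] at h
    have := ENNReal.toReal_le_of_le_ofReal hε.le hmut
    linarith
  have hper := perimeter_union_le hS hRm hPS hPR
  have hu : 0 < volume.real (S ∪ R) := by linarith
  have hPU := finitePerimeter_union hS hRm hPS hPR
  have hle := ldE_le_of_volume hu (by linarith : volume.real (S ∪ R) ≤ a + b) (hS.union hRm) hPU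
    (ENNReal.ofReal_toReal hUv').symm
  refine hle.trans (mul_le_mul ?_ ?_ (add_nonneg (perimeter_nonneg hPU) (coulomb_nonneg _))
    (by positivity))
  · have : 0 < a + b - ε := by linarith
    gcongr
    linarith
  · unfold ldEnergy
    linarith

lemma ldE_add_le {a b : ℝ} (ha : 0 < a) (hb : 0 < b) {e f : ℝ} (he : e ∈ ldValues a)
    (hf : f ∈ ldValues b) : ldE (a + b) ≤ e + f := by
  obtain ⟨S, hS, hPS, hSv, rfl⟩ := he
  obtain ⟨T, hT, hPT, hTv, rfl⟩ := hf
  have hab : a + b ≠ 0 := by positivity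
  have hcont : ContinuousAt (fun ε : ℝ =>
      ((a + b) / (a + b - ε)) ^ 2 * (ldEnergy S + ldEnergy T + ε)) 0 := by
    have : a + b - 0 ≠ 0 := by simpa
    fun_prop (disch := assumption)
  have hlim := hcont.tendsto.mono_left (nhdsWithin_le_nhds (s := Ioi 0))
  simp only [sub_zero, div_self hab, one_pow, one_mul, add_zero] at hlim
  refine ge_of_tendsto hlim ?_
  filter_upwards [Ioo_mem_nhdsGT (by positivity : 0 < a + b)] with ε hε
  exact ldE_add_le_of_pos ha hb hε.1 hε.2 hS hT hPS hPT hSv hTv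

/-- subadditivity of the liquid drop energy. -/
theorem ldE_subadditive (A A' : ℝ) (h0 : 0 < A') (hA : A' < A) :
    ldE A ≤ ldE A' + ldE (A - A') := by
  have hB : 0 < A - A' := sub_pos.2 hA
  have hA0 : 0 < A := h0.trans hA
  by_cases hne : (ldValues A).Nonempty
  · have hne' := ldValues_nonempty hA0 h0 hne
    have hneB := ldValues_nonempty hA0 hB hne
    have h1 : ∀ f ∈ ldValues (A - A'), ldE A - f ≤ ldE A' := fun f hf =>
      le_csInf hne' fun e he => by
        have := ldE_add_le h0 hB he hf
        rw [add_sub_cancel] at this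
        linarith
    have h2 : ldE A - ldE A' ≤ ldE (A - A') := le_csInf hneB fun f hf => by
      linarith [h1 f hf]
    linarith
  · have hzero : ∀ a, 0 < a → ldE a = 0 := fun a ha => by
      have : ldValues a = ∅ :=
        not_nonempty_iff_eq_empty.1 fun h => hne (ldValues_nonempty ha hA0 h)
      change sInf (ldValues a) = 0
      rw [this, Real.sInf_empty]
    rw [hzero A hA0, hzero A' h0, hzero _ hB, add_zero]
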